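/- The polynomial Q̃(x0,x1,y0,y1,z0,z1) = (x0²+x1²)(y0²+y1²)(z0²+z1²) + 3·x0·x1·y0·y1·z0·z1 − 2·x1²·y0·y1·z0·z1 is irreducible in the polynomial ring ℂ[x0,x1,y0,y1,z0,z1]. -/

import Mathlib

open MvPolynomial

/-- The tri-degree (2,2,2) polynomial
`Q̃ = (x0²+x1²)(y0²+y1²)(z0²+z1²) + 3·x0x1y0y1z0z1 − 2·x1²y0y1z0z1`,
with variables `X 0 = x0, X 1 = x1, X 2 = y0, X 3 = y1, X 4 = z0, X 5 = z1`. -/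
noncomputable def Qt : MvPolynomial (Fin 6) ℂ :=
  (X 0 ^ 2 + X 1 ^ 2) * (X 2 ^ 2 + X 3 ^ 2) * (X 4 ^ 2 + X 5 ^ 2)
    + 3 * (X 0 * X 1 * X 2 * X 3 * X 4 * X 5)
    - 2 * (X 1 ^ 2 * X 2 * X 3 * X 4 * X 5)

abbrev R5 := MvPolynomial (Fin 5) ℂ

noncomputable def QA : R5 := (X 1 ^ 2 + X 2 ^ 2) * (X 3 ^ 2 + X 4 ^ 2)
noncomputable def QW : R5 := X 1 * X 2 * X 3 * X 4

lemma Qt_image : finSuccEquiv ℂ 5 Qt =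
    Polynomial.C QA * Polynomial.X ^ 2 + Polynomial.C (3 * X 0 * QW) * Polynomial.X
      + Polynomial.C (X 0 ^ 2 * (QA - 2 * QW)) := by
  have e1 : (1 : Fin 6) = Fin.succ 0 := rfl
  have e2 : (2 : Fin 6) = Fin.succ 1 := rfl
  have e3 : (3 : Fin 6) = Fin.succ 2 := rfl
  have e4 : (4 : Fin 6) = Fin.succ 3 := rfl
  have e5 : (5 : Fin 6) = Fin.succ 4 := rfl
  have c3 : (Polynomial.C (3 : R5)) = 3 := rfl
  have c2 : (Polynomial.C (2 : R5)) = 2 := rfl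
  rw [Qt, e1, e2, e3, e4, e5]
  simp only [map_add, map_sub, map_mul, map_pow, map_ofNat, finSuccEquiv_X_zero,
    finSuccEquiv_X_succ, QA, QW, c3, c2]
  ring

lemma QA_not_dvd (i : Fin 5) : ¬ (X i : R5) ∣ QA := by
  rintro ⟨q, hq⟩
  have h := congrArg (MvPolynomial.eval (fun j => if j = i then (0 : ℂ) else 1)) hq
  fin_cases i <;> simp [QA] at h

lemma unit_of_dvd (a : R5) (h1 : a ∣ QA) (h2 : a ∣ 3 * X 0 * QW) : IsUnit a := by
  by_contra hu
  have hA0 : QA ≠ 0 := fun h => QA_not_dvd 0 (h ▸ dvd_zero _)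
  have ha0 : a ≠ 0 := by
    rintro rfl
    exact hA0 (zero_dvd_iff.mp h1)
  obtain ⟨p, hp, hpa⟩ := WfDvdMonoid.exists_irreducible_factor hu ha0
  have pp : Prime p := hp.prime
  have key : ∀ i, ¬ p ∣ (X i : R5) := by
    intro i hi
    have := hp.dvd_symm (MvPolynomial.X_prime (R := ℂ) (i := i)).irreducible hi
    exact QA_not_dvd i (this.trans (hpa.trans h1))
  have h3 : IsUnit (3 : R5) := by
    have : (3 : R5) = C (3 : ℂ) := (map_ofNat C 3).symm
    rw [this]
    exact (IsUnit.mk0 (3 : ℂ) (by norm_num)).map C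
  have h := hpa.trans h2
  unfold QW at h
  rcases pp.dvd_or_dvd h with h | h
  · rcases pp.dvd_or_dvd h with h | h
    · exact hp.not_isUnit (isUnit_of_dvd_unit h h3)
    · exact key _ h
  · rcases pp.dvd_or_dvd h with h | h
    · rcases pp.dvd_or_dvd h with h | h
      · rcases pp.dvd_or_dvd h with h | h
        · exact key _ h
        · exact key _ h
      · exact key _ h
    · exact key _ h

lemma disc_not_sq (h : R5) :
    (3 * X 0 * QW) ^ 2 - 4 * QA * (X 0 ^ 2 * (QA - 2 * QW)) ≠ h ^ 2 := by
  intro hh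
  have h1 := congrArg (MvPolynomial.aeval
    (![1, Polynomial.X, 1, 1, 1] : Fin 5 → Polynomial ℂ)) hh
  simp only [QA, QW, map_sub, map_mul, map_pow, map_add, map_ofNat, aeval_X] at h1
  generalize (MvPolynomial.aeval
    (![1, Polynomial.X, 1, 1, 1] : Fin 5 → Polynomial ℂ)) h = g at h1
  have h2 : g ^ 2 = Polynomial.C (-16) * Polynomial.X ^ 4 + Polynomial.C 16 * Polynomial.X ^ 3
      + Polynomial.C (-23) * Polynomial.X ^ 2 + Polynomial.C 16 * Polynomial.X
      + Polynomial.C (-16) := by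
    have c16 : (Polynomial.C (16 : ℂ)) = 16 := rfl
    have c23 : (Polynomial.C (23 : ℂ)) = 23 := rfl
    rw [← h1]
    simp [c16, c23]
    ring
  have hd : g.natDegree = 2 := by
    have := congrArg Polynomial.natDegree h2
    rw [Polynomial.natDegree_pow] at this
    have h4 : (Polynomial.C (-16 : ℂ) * Polynomial.X ^ 4 + Polynomial.C 16 * Polynomial.X ^ 3
      + Polynomial.C (-23) * Polynomial.X ^ 2 + Polynomial.C 16 * Polynomial.X
      + Polynomial.C (-16)).natDegree = 4 := by
      compute_degree!
    omega
  obtain ⟨a, b, c, rfl⟩ : ∃ a b c : ℂ, g = Polynomial.C a * Polynomial.X ^ 2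
      + Polynomial.C b * Polynomial.X + Polynomial.C c :=
    ⟨_, _, _, Polynomial.eq_quadratic_of_degree_le_two
      (Polynomial.natDegree_le_iff_degree_le.mp hd.le)⟩
  have ev : ∀ t : ℂ, (a * t ^ 2 + b * t + c) ^ 2
      = -16 * t ^ 4 + 16 * t ^ 3 - 23 * t ^ 2 + 16 * t - 16 := by
    intro t
    have := congrArg (Polynomial.eval t) h2
    simp at this
    linear_combination this
  have v0 := ev 0
  have v1 := ev 1
  have v2 := ev (-1)
  have v3 := ev 2
  have v4 := ev (-2)
  have k0 : c ^ 2 = -16 := by linear_combination v0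
  have k4 : a ^ 2 = -16 := by
    linear_combination (v3 + v4 - 4 * v1 - 4 * v2 + 6 * v0) / 24
  have k2 : b ^ 2 + 2 * a * c = -23 := by
    linear_combination (v1 + v2) / 2 - k0 - k4
  have k3 : a * b = 8 := by
    linear_combination (v3 - v4 - 2 * v1 + 2 * v2) / 24
  have k1 : b * c = 8 := by
    linear_combination (v1 - v2) / 4 - k3
  have hb : b ≠ 0 := by
    rintro rfl
    norm_num at k3
  have hac : a = c := by
    apply mul_left_cancel₀ hb
    linear_combination k3 - k1
  subst hac
  have hb2 : b ^ 2 = 9 := by linear_combination k2 - 2 * k4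
  have : (a * b) ^ 2 = -144 := by
    linear_combination b ^ 2 * k4 - 16 * hb2
  rw [k3] at this
  norm_num at this

lemma quad_irred {R : Type*} [CommRing R] [IsDomain R] (A B D : R) (hA : A ≠ 0)
    (hu : ∀ a, a ∣ A → a ∣ B → IsUnit a) (hs : ∀ h, B ^ 2 - 4 * A * D ≠ h ^ 2) :
    Irreducible (Polynomial.C A * Polynomial.X ^ 2 + Polynomial.C B * Polynomial.X
      + Polynomial.C D) := by
  set q := Polynomial.C A * Polynomial.X ^ 2 + Polynomial.C B * Polynomial.X
      + Polynomial.C D with hq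
  have hdeg : q.natDegree = 2 := Polynomial.natDegree_quadratic hA
  have q2 : q.coeff 2 = A := by simp [hq, Polynomial.coeff_X, Polynomial.coeff_C]
  have q1 : q.coeff 1 = B := by simp [hq, Polynomial.coeff_C]
  have q0 : q.coeff 0 = D := by simp [hq]
  have hq0 : q ≠ 0 := by
    intro h
    rw [h] at hdeg
    simp at hdeg
  have hc : ∀ f g : Polynomial R, q = f * g → f.natDegree = 0 → IsUnit f := by
    intro f g hfg hf
    rw [Polynomial.eq_C_of_natDegree_eq_zero hf] at hfg ⊢
    apply Polynomial.isUnit_C.mpr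
    apply hu
    · exact ⟨g.coeff 2, by rw [← q2, hfg, Polynomial.coeff_C_mul]⟩
    · exact ⟨g.coeff 1, by rw [← q1, hfg, Polynomial.coeff_C_mul]⟩
  refine ⟨fun h => ?_, fun f g hfg => ?_⟩
  · have := Polynomial.natDegree_eq_zero_of_isUnit h
    omega
  · have hf0 : f ≠ 0 := by
      rintro rfl
      simp at hfg
      exact hq0 hfg
    have hg0 : g ≠ 0 := by
      rintro rfl
      simp at hfg
      exact hq0 hfg
    have hsum : f.natDegree + g.natDegree = 2 := by
      rw [← Polynomial.natDegree_mul hf0 hg0, ← hfg, hdeg]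
    rcases Nat.eq_zero_or_pos f.natDegree with h | h
    · exact Or.inl (hc f g hfg h)
    rcases Nat.eq_zero_or_pos g.natDegree with h' | h'
    · exact Or.inr (hc g f (by rw [hfg, mul_comm]) h')
    exfalso
    obtain ⟨a, b, rfl⟩ := Polynomial.exists_eq_X_add_C_of_natDegree_le_one
      (show f.natDegree ≤ 1 by omega)
    obtain ⟨c, d, rfl⟩ := Polynomial.exists_eq_X_add_C_of_natDegree_le_one
      (show g.natDegree ≤ 1 by omega)
    have e : q = Polynomial.C (a * c) * Polynomial.X ^ 2
        + Polynomial.C (a * d + b * c) * Polynomial.X + Polynomial.C (b * d) := by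
      rw [hfg]
      simp only [map_mul, map_add]
      ring
    have r2 : A = a * c := by
      rw [← q2, e]; simp [Polynomial.coeff_X, Polynomial.coeff_C, -map_mul, -map_add]
    have r1 : B = a * d + b * c := by
      rw [← q1, e]; simp [Polynomial.coeff_C, -map_mul, -map_add]
    have r0 : D = b * d := by
      rw [← q0, e]; simp [-map_mul, -map_add]
    apply hs (a * d - b * c)
    rw [r2, r1, r0]
    ring

/-- `Q̃` is irreducible in `ℂ[x0,x1,y0,y1,z0,z1]`. -/
theorem Qt_irreducible : Irreducible Qt := by
  rw [← MulEquiv.irreducible_iff (finSuccEquiv ℂ 5), Qt_image]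
  exact quad_irred _ _ _ (fun h => QA_not_dvd 0 (h ▸ dvd_zero _)) unit_of_dvd disc_not_sq
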